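/- Let (Ĝ, π) be a C₂-graded finite group and let (V, (B_w)) be an irreducible L-representation of (Ĝ, π) whose underlying ℂG-module is simple, and let n ≥ 1. Equip the direct sum V^{⊕n} with the componentwise G-action and with the forms B_w^{(n)}((u₁, …, u_n), (v₁, …, v_n)) := Σᵢ B_w(uᵢ, vᵢ). Then (V^{⊕n}, (B_w^{(n)})) is an L-representation of (Ĝ, π), and the group Aut_L(V^{⊕n}) of its L-automorphisms is isomorphic, as a group, to the complex orthogonal group O_n(ℂ) = {M ∈ GL_n(ℂ) : Mᵀ M = 1}. -/

import Mathlib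

open scoped ComplexConjugate

noncomputable section Defs

variable {Ghat : Type} [Group Ghat]

/-- Conjugate `g ∈ G = ker π` by an arbitrary element `w` of the graded group. -/
def conjKer (π : Ghat →* ℤˣ) (w : Ghat) (g : π.ker) : π.ker :=
  ⟨w * (g : Ghat) * w⁻¹, by
    have hg : π (g : Ghat) = 1 := g.2
    simp [MonoidHom.mem_ker, map_mul, map_inv, hg]⟩

/-- The square `w²` of any element lies in `G = ker π`. -/
def sqKer (π : Ghat →* ℤˣ) (w : Ghat) : π.ker :=
  ⟨w * w, by simp [MonoidHom.mem_ker, map_mul, Int.units_mul_self]⟩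

/-- For odd `w₁, w₂`, the element `w₂ w₁⁻¹` lies in `G = ker π`. -/
def ratioKer (π : Ghat →* ℤˣ) (w₂ w₁ : Ghat) (h₂ : π w₂ = -1) (h₁ : π w₁ = -1) : π.ker :=
  ⟨w₂ * w₁⁻¹, by simp [MonoidHom.mem_ker, map_mul, map_inv, h₁, h₂]⟩

/-- A family of forms `B w` (for odd `w`) making the `G`-representation `ρ` into a
hermitian `K`-representation of the `C₂`-graded group `(Ghat, π)` with respect to the
ring involution `ι` of `K`:  each `B w` is `ι`-sesquilinear, nondegenerate, `w`-invariant,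
`w`-hermitian, and the various forms are compatible. -/
structure IsHermRep (K : Type) [Field K] (ι : K →+* K) (π : Ghat →* ℤˣ)
    {V : Type} [AddCommGroup V] [Module K V]
    (ρ : Representation K π.ker V) (B : Ghat → V → V → K) : Prop where
  add_left : ∀ w, π w = -1 → ∀ u u' v : V, B w (u + u') v = B w u v + B w u' v
  smul_left : ∀ w, π w = -1 → ∀ (a : K) (u v : V), B w (a • u) v = ι a * B w u v
  add_right : ∀ w, π w = -1 → ∀ u v v' : V, B w u (v + v') = B w u v + B w u v'
  smul_right : ∀ w, π w = -1 → ∀ (a : K) (u v : V), B w u (a • v) = a * B w u v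
  nondeg_left : ∀ w, π w = -1 → ∀ u : V, (∀ v, B w u v = 0) → u = 0
  nondeg_right : ∀ w, π w = -1 → ∀ v : V, (∀ u, B w u v = 0) → v = 0
  invariant : ∀ w, π w = -1 → ∀ (g : π.ker) (u v : V),
      B w (ρ g u) (ρ (conjKer π w g) v) = B w u v
  hermitian : ∀ w, π w = -1 → ∀ u v : V, B w u (ρ (sqKer π w) v) = ι (B w v u)
  compat : ∀ w₁ w₂ (h₁ : π w₁ = -1) (h₂ : π w₂ = -1) (u v : V),
      B w₁ u v = B w₂ u (ρ (ratioKer π w₂ w₁ h₂ h₁) v)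

/-- The right orthogonal complement of `W` with respect to the form `B w`. -/
def perp {K : Type} [Field K] {V : Type} [AddCommGroup V] [Module K V]
    (B : Ghat → V → V → K) (W : Submodule K V) (w : Ghat) : Set V :=
  {v : V | ∀ u ∈ W, B w u v = 0}

/-- `W` is a subrepresentation: a `G`-invariant subspace on which every restricted
form is nondegenerate. -/
def IsSubrep (K : Type) [Field K] (π : Ghat →* ℤˣ)
    {V : Type} [AddCommGroup V] [Module K V]
    (ρ : Representation K π.ker V) (B : Ghat → V → V → K) (W : Submodule K V) : Prop :=
  (∀ (g : π.ker), ∀ v ∈ W, ρ g v ∈ W) ∧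
  ∀ w, π w = -1 →
    (∀ u ∈ W, (∀ v ∈ W, B w u v = 0) → u = 0) ∧
    (∀ v ∈ W, (∀ u ∈ W, B w u v = 0) → v = 0)

/-- The hermitian representation `(V, B)` is irreducible. -/
def IsIrredRep (K : Type) [Field K] (π : Ghat →* ℤˣ)
    {V : Type} [AddCommGroup V] [Module K V]
    (ρ : Representation K π.ker V) (B : Ghat → V → V → K) : Prop :=
  (∃ v : V, v ≠ 0) ∧ ∀ W : Submodule K V, IsSubrep K π ρ B W → W = ⊥ ∨ W = ⊤

/-- `W` is an irreducible subrepresentation. -/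
def IsIrredSubrep (K : Type) [Field K] (π : Ghat →* ℤˣ)
    {V : Type} [AddCommGroup V] [Module K V]
    (ρ : Representation K π.ker V) (B : Ghat → V → V → K) (W : Submodule K V) : Prop :=
  IsSubrep K π ρ B W ∧ W ≠ ⊥ ∧
    ∀ U : Submodule K V, U ≤ W → IsSubrep K π ρ B U → U = ⊥ ∨ U = W

/-- `W` is a `G`-invariant subspace that is simple as a `KG`-module. -/
def IsSimpleGSub (K : Type) [Field K] (π : Ghat →* ℤˣ)
    {V : Type} [AddCommGroup V] [Module K V]
    (ρ : Representation K π.ker V) (W : Submodule K V) : Prop :=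
  (∀ (g : π.ker), ∀ v ∈ W, ρ g v ∈ W) ∧ W ≠ ⊥ ∧
    ∀ U : Submodule K V, U ≤ W → (∀ (g : π.ker), ∀ v ∈ U, ρ g v ∈ U) → U = ⊥ ∨ U = W

/-- The group of automorphisms of a hermitian representation: the `G`-equivariant linear
automorphisms preserving every form `B w`. -/
def AutRep (K : Type) [Field K] (π : Ghat →* ℤˣ)
    {V : Type} [AddCommGroup V] [Module K V]
    (ρ : Representation K π.ker V) (B : Ghat → V → V → K) : Subgroup (V ≃ₗ[K] V) where
  carrier := {f | (∀ (g : π.ker) (v : V), f (ρ g v) = ρ g (f v)) ∧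
      ∀ w, π w = -1 → ∀ u v : V, B w (f u) (f v) = B w u v}
  one_mem' := ⟨fun _ _ => rfl, fun _ _ _ _ => rfl⟩
  mul_mem' := by
    rintro f g ⟨hf1, hf2⟩ ⟨hg1, hg2⟩
    refine ⟨fun a v => ?_, fun w hw u v => ?_⟩
    · show f (g (ρ a v)) = ρ a (f (g v))
      rw [hg1, hf1]
    · show B w (f (g u)) (f (g v)) = B w u v
      rw [hf2 w hw, hg2 w hw]
  inv_mem' := by
    rintro f ⟨hf1, hf2⟩
    refine ⟨fun g v => ?_, fun w hw u v => ?_⟩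
    · apply f.injective
      show f (f.symm (ρ g v)) = f (ρ g (f.symm v))
      rw [f.apply_symm_apply, hf1, f.apply_symm_apply]
    · show B w (f.symm u) (f.symm v) = B w u v
      conv_rhs => rw [← f.apply_symm_apply u, ← f.apply_symm_apply v]
      exact (hf2 w hw _ _).symm

/-- Linear (`L`-) representations: the hermitian theory over `ℂ` with the trivial involution. -/
abbrev IsLRep (π : Ghat →* ℤˣ) {V : Type} [AddCommGroup V] [Module ℂ V]
    (ρ : Representation ℂ π.ker V) (B : Ghat → V → V → ℂ) : Prop :=
  IsHermRep ℂ (RingHom.id ℂ) π ρ B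

/-- Hermitian (`H`-) representations: the hermitian theory over `ℂ` with complex conjugation. -/
abbrev IsHRep (π : Ghat →* ℤˣ) {V : Type} [AddCommGroup V] [Module ℂ V]
    (ρ : Representation ℂ π.ker V) (B : Ghat → V → V → ℂ) : Prop :=
  IsHermRep ℂ (starRingEnd ℂ) π ρ B

/-- An antilinear (`A`-) representation of the `C₂`-graded group `(Ghat, π)`: an action of the
whole group `Ghat` by additive automorphisms in which even elements act `ℂ`-linearly and odd
elements act conjugate-linearly. -/
structure IsARep (π : Ghat →* ℤˣ) {V : Type} [AddCommGroup V] [Module ℂ V]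
    (a : Ghat → V → V) : Prop where
  map_add : ∀ (z : Ghat) (u v : V), a z (u + v) = a z u + a z v
  map_smul_even : ∀ z, π z = 1 → ∀ (c : ℂ) (v : V), a z (c • v) = c • a z v
  map_smul_odd : ∀ z, π z = -1 → ∀ (c : ℂ) (v : V), a z (c • v) = (starRingEnd ℂ c) • a z v
  map_one : ∀ v : V, a 1 v = v
  map_mul : ∀ (z₁ z₂ : Ghat) (v : V), a (z₁ * z₂) v = a z₁ (a z₂ v)

/-- The componentwise action of `G` on the direct sum `V^{⊕n}`. -/
def piRep (π : Ghat →* ℤˣ) {V : Type} [AddCommGroup V] [Module ℂ V]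
    (ρ : Representation ℂ π.ker V) (n : ℕ) : Representation ℂ π.ker (Fin n → V) where
  toFun g := LinearMap.pi fun i => (ρ g) ∘ₗ LinearMap.proj i
  map_one' := by
    ext v i
    simp
  map_mul' g h := by
    ext v i
    simp

/-- The orthogonal sum of the forms `B w` on the direct sum `V^{⊕n}`. -/
def sumForm {V : Type} [AddCommGroup V] [Module ℂ V]
    (B : Ghat → V → V → ℂ) (n : ℕ) : Ghat → (Fin n → V) → (Fin n → V) → ℂ :=
  fun w u v => ∑ i, B w (u i) (v i)

/-- The bilinear forms `B_w(u,v) = ⟨u, w⁻¹·v⟩ + ⟨v, w·u⟩` associated with an invariant inner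
product on an `A`-representation. -/
def assocForm {V : Type} [AddCommGroup V] [Module ℂ V]
    (a : Ghat → V → V) (h : V → V → ℂ) : Ghat → V → V → ℂ :=
  fun w u v => h u (a w⁻¹ v) + h v (a w u)

end Defs

section BlockMap

variable {V : Type} [AddCommGroup V] [Module ℂ V] {n : ℕ}

/-- A square matrix acting on `V^{⊕n}` through its entries. -/
def blockMap (M : Matrix (Fin n) (Fin n) ℂ) : (Fin n → V) →ₗ[ℂ] (Fin n → V) :=
  LinearMap.pi fun i => ∑ j, M i j • LinearMap.proj j

theorem blockMap_apply (M : Matrix (Fin n) (Fin n) ℂ) (v : Fin n → V) (i : Fin n) :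
    blockMap M v i = ∑ j, M i j • v j := by
  simp [blockMap]

theorem blockMap_one :
    blockMap (1 : Matrix (Fin n) (Fin n) ℂ) = (LinearMap.id : (Fin n → V) →ₗ[ℂ] _) := by
  refine LinearMap.ext fun v => funext fun i => ?_
  simp [blockMap_apply, Matrix.one_apply, ite_smul]

theorem blockMap_mul (M N : Matrix (Fin n) (Fin n) ℂ) (v : Fin n → V) :
    blockMap (M * N) v = blockMap M (blockMap N v) := by
  funext i
  simp only [blockMap_apply, Matrix.mul_apply, Finset.sum_smul, Finset.smul_sum, mul_smul]
  exact Finset.sum_comm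

theorem blockMap_single (M : Matrix (Fin n) (Fin n) ℂ) (v : V) (i j : Fin n) :
    blockMap M (Pi.single j v) i = M i j • v := by
  rw [blockMap_apply, Finset.sum_eq_single j] <;> simp +contextual

theorem blockMap_injective [Nontrivial V] :
    Function.Injective (blockMap : Matrix (Fin n) (Fin n) ℂ → (Fin n → V) →ₗ[ℂ] (Fin n → V)) := by
  intro M N h
  obtain ⟨v, hv⟩ := exists_ne (0 : V)
  ext i j
  have := congrFun (LinearMap.congr_fun h (Pi.single j v)) i
  rw [blockMap_single, blockMap_single] at this
  exact smul_left_injective ℂ hv this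

/-- The automorphism of `V^{⊕n}` given by an orthogonal matrix. -/
def blockEquiv (M : Matrix (Fin n) (Fin n) ℂ) (h : M * M.transpose = 1)
    (h' : M.transpose * M = 1) : (Fin n → V) ≃ₗ[ℂ] (Fin n → V) :=
  LinearEquiv.ofLinearMap (blockMap M) (blockMap M.transpose)
    (LinearMap.ext fun v => by simp [← blockMap_mul, h, blockMap_one])
    (LinearMap.ext fun v => by simp [← blockMap_mul, h', blockMap_one])

end BlockMap

section LRep

variable {Ghat : Type} [Group Ghat] {π : Ghat →* ℤˣ} {V : Type} [AddCommGroup V] [Module ℂ V]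
  {ρ : Representation ℂ π.ker V} {B : Ghat → V → V → ℂ} {n : ℕ}

theorem piRep_apply (g : π.ker) (v : Fin n → V) (i : Fin n) :
    piRep π ρ n g v i = ρ g (v i) := rfl

theorem piRep_single (g : π.ker) (v : V) (i : Fin n) :
    piRep π ρ n g (Pi.single i v) = Pi.single i (ρ g v) := by
  funext j
  rw [piRep_apply]
  exact Pi.apply_single (fun _ => ρ g) (fun _ => map_zero _) i v j

theorem IsHermRep.zero_left (hB : IsLRep π ρ B) {w : Ghat} (hw : π w = -1) (v : V) :
    B w 0 v = 0 := by
  simpa using hB.smul_left w hw 0 0 v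

theorem IsHermRep.zero_right (hB : IsLRep π ρ B) {w : Ghat} (hw : π w = -1) (u : V) :
    B w u 0 = 0 := by
  simpa using hB.smul_right w hw 0 u 0

theorem IsHermRep.sum_smul_left (hB : IsLRep π ρ B) {w : Ghat} (hw : π w = -1)
    (c : Fin n → ℂ) (u : Fin n → V) (v : V) :
    B w (∑ i, c i • u i) v = ∑ i, c i * B w (u i) v := by
  let φ : V →+ ℂ := ⟨⟨fun u => B w u v, hB.zero_left hw v⟩, fun a b => hB.add_left w hw a b v⟩
  exact (map_sum φ _ _).trans (Finset.sum_congr rfl fun i _ => hB.smul_left w hw _ _ _)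

theorem IsHermRep.sum_smul_right (hB : IsLRep π ρ B) {w : Ghat} (hw : π w = -1)
    (c : Fin n → ℂ) (u : V) (v : Fin n → V) :
    B w u (∑ i, c i • v i) = ∑ i, c i * B w u (v i) := by
  let φ : V →+ ℂ := ⟨⟨fun v => B w u v, hB.zero_right hw u⟩, fun a b => hB.add_right w hw u a b⟩
  exact (map_sum φ _ _).trans (Finset.sum_congr rfl fun i _ => hB.smul_right w hw _ _ _)

theorem sumForm_single_left (hB : IsLRep π ρ B) {w : Ghat} (hw : π w = -1)
    (i : Fin n) (u : V) (v : Fin n → V) :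
    sumForm B n w (Pi.single i u) v = B w u (v i) := by
  rw [sumForm, Finset.sum_eq_single i]
  · simp
  · intro j _ hj
    rw [Pi.single_eq_of_ne hj, hB.zero_left hw]
  · simp

theorem sumForm_single_right (hB : IsLRep π ρ B) {w : Ghat} (hw : π w = -1)
    (i : Fin n) (u : Fin n → V) (v : V) :
    sumForm B n w u (Pi.single i v) = B w (u i) v := by
  rw [sumForm, Finset.sum_eq_single i]
  · simp
  · intro j _ hj
    rw [Pi.single_eq_of_ne hj, hB.zero_right hw]
  · simp

theorem isLRep_piRep (hB : IsLRep π ρ B) (n : ℕ) : IsLRep π (piRep π ρ n) (sumForm B n) where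
  add_left w hw u u' v := by
    simp [sumForm, hB.add_left w hw, Finset.sum_add_distrib]
  smul_left w hw a u v := by
    simp [sumForm, hB.smul_left w hw, Finset.mul_sum]
  add_right w hw u v v' := by
    simp [sumForm, hB.add_right w hw, Finset.sum_add_distrib]
  smul_right w hw a u v := by
    simp [sumForm, hB.smul_right w hw, Finset.mul_sum]
  nondeg_left w hw u h := funext fun i => hB.nondeg_left w hw _ fun v => by
    rw [← sumForm_single_right hB hw, h]
  nondeg_right w hw v h := funext fun i => hB.nondeg_right w hw _ fun u => by
    rw [← sumForm_single_left hB hw, h]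
  invariant w hw g u v := Finset.sum_congr rfl fun i _ => hB.invariant w hw g (u i) (v i)
  hermitian w hw u v := Finset.sum_congr rfl fun i _ => hB.hermitian w hw (u i) (v i)
  compat w₁ w₂ h₁ h₂ u v := Finset.sum_congr rfl fun i _ => hB.compat w₁ w₂ h₁ h₂ (u i) (v i)

theorem sumForm_blockMap_left (hB : IsLRep π ρ B) {w : Ghat} (hw : π w = -1)
    (M : Matrix (Fin n) (Fin n) ℂ) (u v : Fin n → V) :
    sumForm B n w (blockMap M u) v = sumForm B n w u (blockMap M.transpose v) := by
  simp only [sumForm, blockMap_apply, hB.sum_smul_left hw, hB.sum_smul_right hw,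
    Matrix.transpose_apply]
  exact Finset.sum_comm

theorem blockMap_piRep (M : Matrix (Fin n) (Fin n) ℂ) (g : π.ker) (v : Fin n → V) :
    blockMap M (piRep π ρ n g v) = piRep π ρ n g (blockMap M v) := by
  funext i
  simp [piRep_apply, blockMap_apply]

theorem sumForm_blockMap_iff [Nontrivial V] (hB : IsLRep π ρ B) {w : Ghat} (hw : π w = -1)
    (M : Matrix (Fin n) (Fin n) ℂ) :
    (∀ u v : Fin n → V, sumForm B n w (blockMap M u) (blockMap M v) = sumForm B n w u v) ↔
      M.transpose * M = 1 := by
  simp only [sumForm_blockMap_left hB hw, ← blockMap_mul]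
  refine ⟨fun h => ?_, fun h u v => by rw [h, blockMap_one, LinearMap.id_apply]⟩
  apply blockMap_injective (V := V)
  rw [blockMap_one]
  refine LinearMap.ext fun v => sub_eq_zero.1 ?_
  refine (isLRep_piRep hB n).nondeg_right w hw _ fun u => ?_
  rw [sub_eq_add_neg, ← neg_one_smul ℂ, (isLRep_piRep hB n).add_right w hw,
    (isLRep_piRep hB n).smul_right w hw, h]
  simp

/-- Schur's lemma. -/
theorem IsSimpleGSub.exists_eq_smul [FiniteDimensional ℂ V] [Nontrivial V]
    (hsimple : IsSimpleGSub ℂ π ρ (⊤ : Submodule ℂ V)) (f : V →ₗ[ℂ] V)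
    (hf : ∀ (g : π.ker) (v : V), f (ρ g v) = ρ g (f v)) : ∃ c : ℂ, ∀ v, f v = c • v := by
  obtain ⟨c, hc⟩ := Module.End.exists_eigenvalue f
  refine ⟨c, fun v => ?_⟩
  have h := (hsimple.2.2 (Module.End.eigenspace f c) le_top fun g v hv => by
    rw [Module.End.mem_eigenspace_iff] at hv ⊢
    rw [hf, hv, map_smul]).resolve_left hc
  exact Module.End.mem_eigenspace_iff.1 (h ▸ Submodule.mem_top)

theorem IsSimpleGSub.exists_eq_blockMap [FiniteDimensional ℂ V] [Nontrivial V]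
    (hsimple : IsSimpleGSub ℂ π ρ (⊤ : Submodule ℂ V)) (f : (Fin n → V) →ₗ[ℂ] (Fin n → V))
    (hf : ∀ (g : π.ker) (v : Fin n → V), f (piRep π ρ n g v) = piRep π ρ n g (f v)) :
    ∃ M, f = blockMap M := by
  have key (i j : Fin n) : ∃ c : ℂ, ∀ v : V, f (Pi.single j v) i = c • v :=
    hsimple.exists_eq_smul (LinearMap.proj i ∘ₗ f ∘ₗ LinearMap.single ℂ (fun _ => V) j)
      fun g v => by
        simp only [LinearMap.comp_apply, LinearMap.single_apply, LinearMap.proj_apply]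
        rw [← piRep_single, hf, piRep_apply]
  choose M hM using key
  refine ⟨Matrix.of M, LinearMap.pi_ext fun j v => funext fun i => ?_⟩
  rw [hM, blockMap_single, Matrix.of_apply]

end LRep

/-- For an irreducible `L`-representation `V` with simple underlying `ℂG`-module, the direct sum
`V^{⊕n}` with the orthogonal sum of the forms is again an `L`-representation, and its
`L`-automorphism group is isomorphic to the complex orthogonal group `O_n(ℂ)`. -/
theorem isotypic_L_aut_eq_orthogonal
    {Ghat : Type} [Group Ghat] [Finite Ghat] (π : Ghat →* ℤˣ)
    (hπ : Function.Surjective π)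
    {V : Type} [AddCommGroup V] [Module ℂ V] [FiniteDimensional ℂ V]
    (ρ : Representation ℂ π.ker V) (B : Ghat → V → V → ℂ)
    (hB : IsLRep π ρ B) (hirr : IsIrredRep ℂ π ρ B)
    (hsimple : IsSimpleGSub ℂ π ρ (⊤ : Submodule ℂ V))
    (n : ℕ) (hn : 1 ≤ n) :
    IsLRep π (piRep π ρ n) (sumForm B n) ∧
    Nonempty (AutRep ℂ π (piRep π ρ n) (sumForm B n) ≃* Matrix.orthogonalGroup (Fin n) ℂ) := by
  obtain ⟨v₀, hv₀⟩ := hirr.1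
  have : Nontrivial V := ⟨v₀, 0, hv₀⟩
  obtain ⟨w₀, hw₀⟩ := hπ (-1)
  let φ : Matrix.orthogonalGroup (Fin n) ℂ →* AutRep ℂ π (piRep π ρ n) (sumForm B n) :=
    { toFun := fun M => ⟨blockEquiv M.1 ((Matrix.mem_orthogonalGroup_iff _ _).1 M.2)
        ((Matrix.mem_orthogonalGroup_iff' _ _).1 M.2), blockMap_piRep M.1, fun w hw =>
          (sumForm_blockMap_iff hB hw M.1).2 ((Matrix.mem_orthogonalGroup_iff' _ _).1 M.2)⟩
      map_one' := Subtype.ext (LinearEquiv.toLinearMap_injective blockMap_one)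
      map_mul' := fun M N => Subtype.ext (LinearEquiv.ext (blockMap_mul M.1 N.1)) }
  refine ⟨isLRep_piRep hB n, ⟨(MulEquiv.ofBijective φ ⟨fun M N h => ?_, fun f => ?_⟩).symm⟩⟩
  · exact Subtype.ext (blockMap_injective (V := V)
      (congrArg (fun f => (f.1 : (Fin n → V) →ₗ[ℂ] (Fin n → V))) h))
  · obtain ⟨f, hf, hf'⟩ := f
    obtain ⟨M, hM⟩ := hsimple.exists_eq_blockMap f.toLinearMap hf
    have hM' (v) : f v = blockMap M v := LinearMap.congr_fun hM v
    refine ⟨⟨M, (Matrix.mem_orthogonalGroup_iff' _ _).2 ((sumForm_blockMap_iff hB hw₀ M).1 ?_)⟩,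
      Subtype.ext (LinearEquiv.ext fun v => (hM' v).symm)⟩
    simpa only [hM'] using hf' w₀ hw₀
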